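/- (Theorem 1, maximum number of MAC conditions.) Let τ ≥ 1 and L ≥ 1 be natural numbers, n = τ + L, W = C(n−1, τ), M_T = C(n, τ+1). Let 𝒟 be a family of i distinct (τ+1)-element subsets of the n-element user set with 1 ≤ i ≤ M_T, let deg_k(𝒟) be the number of members of 𝒟 containing user k, and let m_1, …, m_n be natural numbers with ∑_k m_k = m and deg_k(𝒟) + m_k ≤ W for every k; set w_k = W − deg_k(𝒟) − m_k. Let U be the least natural number with C(U, τ+1) ≥ i, X = i − C(U−1, τ+1), and φ = ⌊m / (W − C(U−2, τ))⌋, and assume φ + 1 ≤ U. Then ∑_{k=1}^{n} (2^{w_k} − 1) ≤ (n − U)(2^W − 1) + (U − (φ + 1))(2^{W − C(U−2, τ)} − 1) + (2^{W − X} − 1). -/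

import Mathlib

open Finset

/-- The number of members of `𝒟` containing `k`. -/
def famDegree {α : Type*} [DecidableEq α] (𝒟 : Finset (Finset α)) (k : α) : ℕ :=
  (𝒟.filter (fun D => k ∈ D)).card

/-- The concave function `1 - 2⁻ᵈ`. -/
noncomputable def halfGain (d : ℕ) : ℝ := 1 - (1 / 2) ^ d

lemma halfGain_zero : halfGain 0 = 0 := by simp [halfGain]

lemma halfGain_mono {a b : ℕ} (h : a ≤ b) : halfGain a ≤ halfGain b := by
  have : ((1 : ℝ) / 2) ^ b ≤ (1 / 2) ^ a := pow_le_pow_of_le_one (by norm_num) (by norm_num) h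
  unfold halfGain; linarith

lemma halfGain_nonneg (d : ℕ) : 0 ≤ halfGain d := by
  simpa [halfGain_zero] using halfGain_mono (Nat.zero_le d)

lemma halfGain_add_le (a b : ℕ) : halfGain (a + b) ≤ halfGain a + halfGain b := by
  have h := mul_nonneg (halfGain_nonneg a) (halfGain_nonneg b)
  unfold halfGain at *
  rw [pow_add]
  nlinarith

lemma halfGain_sum_le {α : Type*} (J : Finset α) (d : α → ℕ) :
    halfGain (∑ k ∈ J, d k) ≤ ∑ k ∈ J, halfGain (d k) := by
  classical
  induction J using Finset.induction_on with
  | empty => simp [halfGain_zero]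
  | insert a s ha ih =>
    rw [sum_insert ha, sum_insert ha]
    linarith [halfGain_add_le (d a) (∑ k ∈ s, d k)]

lemma sum_halfGain {α : Type*} (J : Finset α) (d : α → ℕ) :
    ∑ k ∈ J, halfGain (d k) = J.card - ∑ k ∈ J, (1 / 2 : ℝ) ^ d k := by
  simp [halfGain, sum_sub_distrib]

lemma card_le_choose_of_uniform {α : Type*} {𝒟 : Finset (Finset α)} {V : Finset α} {r : ℕ}
    (h : ∀ D ∈ 𝒟, D ⊆ V ∧ D.card = r) : 𝒟.card ≤ V.card.choose r := by
  rw [← card_powersetCard]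
  exact card_le_card fun D hD => mem_powersetCard.2 (h D hD)

section Families
variable {α : Type*} [DecidableEq α]

lemma famDegree_add_card_filter_notMem (𝒟 : Finset (Finset α)) (v : α) :
    famDegree 𝒟 v + (𝒟.filter (fun D => v ∉ D)).card = 𝒟.card :=
  card_filter_add_card_filter_not _

lemma card_filter_notMem_le {𝒟 : Finset (Finset α)} {V : Finset α} {r : ℕ}
    (h : ∀ D ∈ 𝒟, D ⊆ V ∧ D.card = r) {v : α} (hv : v ∈ V) :
    (𝒟.filter (fun D => v ∉ D)).card ≤ (V.card - 1).choose r := by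
  rw [← card_erase_of_mem hv]
  refine card_le_choose_of_uniform fun D hD => ?_
  rw [mem_filter] at hD
  exact ⟨subset_erase.2 ⟨(h D hD.1).1, hD.2⟩, (h D hD.1).2⟩

lemma sum_famDegree_eq (𝒟 : Finset (Finset α)) (J : Finset α) :
    ∑ k ∈ J, famDegree 𝒟 k = ∑ D ∈ 𝒟, (J ∩ D).card := by
  simp only [famDegree, card_filter]
  rw [sum_comm]
  refine sum_congr rfl fun D _ => ?_
  rw [← card_filter, filter_mem_eq_inter]

lemma card_le_choose_add_sum_famDegree {𝒟 : Finset (Finset α)} {S J : Finset α} {r : ℕ}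
    (h : ∀ D ∈ 𝒟, D ⊆ S ∪ J ∧ D.card = r) :
    𝒟.card ≤ S.card.choose r + ∑ k ∈ J, famDegree 𝒟 k := by
  rw [← card_filter_add_card_filter_not (fun D => D ⊆ S) (s := 𝒟), sum_famDegree_eq]
  refine add_le_add (card_le_choose_of_uniform fun D hD => ?_) ?_
  · rw [mem_filter] at hD
    exact ⟨hD.2, (h D hD.1).2⟩
  · rw [card_filter]
    refine sum_le_sum fun D hD => ?_
    split_ifs with hS
    · exact Nat.zero_le _
    · obtain ⟨x, hx, hxS⟩ := not_subset.1 hS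
      refine card_pos.2 ⟨x, mem_inter.2 ⟨?_, hx⟩⟩
      exact (mem_union.1 ((h D hD).1 hx)).resolve_left hxS

lemma sum_famDegree_of_uniform {𝒟 : Finset (Finset α)} {V : Finset α} {r : ℕ}
    (h : ∀ D ∈ 𝒟, D ⊆ V ∧ D.card = r) : ∑ k ∈ V, famDegree 𝒟 k = r * 𝒟.card := by
  rw [sum_famDegree_eq, mul_comm, ← smul_eq_mul, ← sum_const]
  refine sum_congr rfl fun D hD => ?_
  rw [inter_eq_right.2 (h D hD).1, (h D hD).2]

lemma famDegree_le_choose {𝒟 : Finset (Finset α)} {V : Finset α} {r : ℕ}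
    (h : ∀ D ∈ 𝒟, D ⊆ V ∧ D.card = r + 1) {v : α} (hv : v ∈ V) :
    famDegree 𝒟 v ≤ (V.card - 1).choose r := by
  rw [← card_erase_of_mem hv, ← card_powersetCard]
  refine card_le_card_of_injOn (fun D => D.erase v) (fun D hD => ?_) ?_
  · simp only [coe_filter, Set.mem_ofPred_eq] at hD
    simp only [mem_coe]
    rw [mem_powersetCard, card_erase_of_mem hD.2, (h D hD.1).2]
    exact ⟨erase_subset_erase _ (h D hD.1).1, rfl⟩
  · intro D hD E hE hDE
    simp only [coe_filter, Set.mem_ofPred_eq] at hD hE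
    rw [← insert_erase hD.2, ← insert_erase hE.2]
    simp only at hDE
    rw [hDE]

lemma famDegree_filter_le (𝒟 : Finset (Finset α)) (p : Finset α → Prop) [DecidablePred p] (k : α) :
    famDegree (𝒟.filter p) k ≤ famDegree 𝒟 k :=
  card_le_card (filter_subset_filter _ (filter_subset _ _))

lemma add_choose_le_famDegree_add_famDegree {𝒟 : Finset (Finset α)} {V : Finset α} {r u X : ℕ}
    (h : ∀ D ∈ 𝒟, D ⊆ V ∧ D.card = r + 1) (hu : 1 ≤ u) (hV : V.card = u + 1)
    (hcard : 𝒟.card = u.choose (r + 1) + X) {j k : α} (hj : j ∈ V) (hk : k ∈ V) (hjk : j ≠ k) :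
    X + (u - 1).choose r ≤ famDegree 𝒟 j + famDegree 𝒟 k := by
  have h1 := famDegree_add_card_filter_notMem 𝒟 j
  have h2 := famDegree_add_card_filter_notMem (𝒟.filter (fun D => j ∉ D)) k
  have h3 := famDegree_filter_le 𝒟 (fun D => j ∉ D) k
  have h4 : ((𝒟.filter (fun D => j ∉ D)).filter (fun D => k ∉ D)).card ≤
      ((V.erase j).card - 1).choose (r + 1) := by
    refine card_filter_notMem_le (fun D hD => ?_) (mem_erase.2 ⟨hjk.symm, hk⟩)
    rw [mem_filter] at hD
    exact ⟨subset_erase.2 ⟨(h D hD.1).1, hD.2⟩, (h D hD.1).2⟩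
  rw [card_erase_of_mem hj, hV] at h4
  obtain ⟨u, rfl⟩ := Nat.exists_eq_add_of_le' hu
  have h5 := Nat.choose_succ_succ u r
  simp only [Nat.add_sub_cancel, Nat.succ_eq_add_one] at *
  omega

/-- Complementing both the family and its members. -/
lemma famDegree_dual {𝒟 : Finset (Finset α)} {V : Finset α} {r u X : ℕ}
    (h : ∀ D ∈ 𝒟, D ⊆ V ∧ D.card = r + 1) (hV : V.card = u + 1)
    (hcard : 𝒟.card = u.choose (r + 1) + X) (hr : r ≤ u) :
    ∃ ℰ : Finset (Finset α), (∀ D ∈ ℰ, D ⊆ V ∧ D.card = u - r) ∧ ℰ.card + X = u.choose r ∧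
      ∀ k ∈ V, famDegree ℰ k + X = famDegree 𝒟 k := by
  set ℱ := V.powersetCard (r + 1) \ 𝒟 with hℱ
  have hsub : 𝒟 ⊆ V.powersetCard (r + 1) := fun D hD => mem_powersetCard.2 (h D hD)
  have hF : ∀ D ∈ ℱ, D ⊆ V ∧ D.card = r + 1 := fun D hD =>
    mem_powersetCard.1 (mem_sdiff.1 hD).1
  have hinj : Set.InjOn (fun D => V \ D) (ℱ : Set (Finset α)) := by
    intro D hD E hE hDE
    simp only at hDE
    rw [← Finset.sdiff_sdiff_eq_self (hF D hD).1, hDE, Finset.sdiff_sdiff_eq_self (hF E hE).1]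
  refine ⟨ℱ.image (fun D => V \ D), ?_, ?_, ?_⟩
  · simp only [mem_image, forall_exists_index, and_imp, forall_apply_eq_imp_iff₂]
    intro D hD
    refine ⟨sdiff_subset, ?_⟩
    rw [card_sdiff_of_subset (hF D hD).1, hV, (hF D hD).2]
    omega
  · rw [card_image_of_injOn hinj, hℱ, card_sdiff_of_subset hsub, card_powersetCard, hV, hcard]
    have h1 := card_le_card hsub
    rw [card_powersetCard, hV, hcard] at h1
    have h5 := Nat.choose_succ_succ u r
    simp only [Nat.succ_eq_add_one] at *
    omega
  · intro k hk
    have h1 : famDegree (ℱ.image (fun D => V \ D)) k = (ℱ.filter (fun D => k ∉ D)).card := by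
      rw [famDegree, filter_image, card_image_of_injOn (hinj.mono fun D hD => (mem_filter.1 hD).1)]
      simp [hk]
    have h2 : (ℱ.filter (fun D => k ∉ D)).card + (𝒟.filter (fun D => k ∉ D)).card
        = u.choose (r + 1) := by
      rw [← card_union_of_disjoint]
      · rw [← filter_union, hℱ, sdiff_union_of_subset hsub]
        have : u = (V.erase k).card := by rw [card_erase_of_mem hk, hV]; rfl
        rw [this, ← card_powersetCard]
        congr 1
        ext D
        simp only [mem_filter, mem_powersetCard, subset_erase]
        tauto
      · exact disjoint_filter_filter sdiff_disjoint
    have h3 := famDegree_add_card_filter_notMem 𝒟 k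
    omega

/-- If every set avoiding `v` that adds at most two elements to `D₀` belongs to the family, then
every other element outside `D₀` has large degree. -/
lemma mul_le_famDegree {𝒟 : Finset (Finset α)} {V D₀ : Finset α} {r : ℕ} {v w : α}
    (hD₀ : D₀ ⊆ V) (hD₀c : D₀.card = r + 1) (hv : v ∈ D₀) (hwV : w ∈ V) (hw : w ∉ D₀)
    (hall : ∀ E ⊆ V, E.card = r + 1 → v ∉ E → (E \ D₀).card ≤ 2 → E ∈ 𝒟) :
    r * (V.card - (r + 2)) ≤ famDegree 𝒟 w := by
  have hT : (D₀.erase v).card = r := by rw [card_erase_of_mem hv, hD₀c]; rfl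
  have hY : (V \ insert w D₀).card = V.card - (r + 2) := by
    rw [card_sdiff_of_subset (insert_subset hwV hD₀), card_insert_of_notMem hw, hD₀c]
  rw [← hY, ← hT, ← card_product]
  have hvw : v ≠ w := fun h => hw (h ▸ hv)
  refine card_le_card_of_injOn
    (fun p => insert w (insert p.2 ((D₀.erase v).erase p.1))) ?_ ?_
  · rintro ⟨x, y⟩ hp
    simp only [coe_product, Set.mem_prod, mem_coe, mem_sdiff, mem_insert, not_or] at hp
    obtain ⟨hx, hyV, hyw, hyD⟩ := hp
    have hxr : 1 ≤ r := by rw [← hT]; exact card_pos.2 ⟨x, hx⟩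
    simp only [mem_coe, mem_filter]
    refine ⟨hall _ ?_ ?_ ?_ ?_, mem_insert_self _ _⟩
    · refine insert_subset hwV (insert_subset hyV ?_)
      exact (erase_subset _ _).trans ((erase_subset _ _).trans hD₀)
    · rw [card_insert_of_notMem, card_insert_of_notMem, card_erase_of_mem hx, hT]
      · omega
      · simp [hyD]
      · simp [hw, Ne.symm hyw]
    · have : v ≠ y := fun h => hyD (h ▸ hv)
      simp [hvw, this]
    · refine (card_le_card (t := {w, y}) ?_).trans card_le_two
      intro z
      simp only [mem_sdiff, mem_insert, mem_erase, mem_singleton]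
      tauto
  · rintro ⟨x, y⟩ hp ⟨x', y'⟩ hp' heq
    simp only [coe_product, Set.mem_prod, mem_coe, mem_sdiff, mem_insert, not_or, mem_erase] at *
    simp only [Finset.ext_iff, mem_insert, mem_erase] at heq
    have h1 := heq x
    have h2 := heq y
    have hxw : x ≠ w := fun h => hw (h ▸ hp.1.2)
    have hxy' : x ≠ y' := fun h => hp'.2.2.2 (h ▸ hp.1.2)
    have hxy : x ≠ y := fun h => hp.2.2.2 (h ▸ hp.1.2)
    refine Prod.ext ?_ ?_ <;> simp only <;> tauto

/-- Replacing one member of the family by another set. -/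
lemma sum_halfGain_swap_le {𝒟 : Finset (Finset α)} {J D₀ E : Finset α} {v : α}
    (hD₀ : D₀ ∈ 𝒟) (hE : E ∉ 𝒟) (hvD : v ∈ D₀) (hvE : v ∉ E) (hvJ : v ∈ J)
    (hsum : ∑ w ∈ (E \ D₀) ∩ J, (1 / 2 : ℝ) ^ (famDegree 𝒟 w + 1) ≤ (1 / 2) ^ famDegree 𝒟 v) :
    famDegree (insert E (𝒟.erase D₀)) v + 1 = famDegree 𝒟 v ∧
    ∑ k ∈ J, halfGain (famDegree (insert E (𝒟.erase D₀)) k) ≤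
      ∑ k ∈ J, halfGain (famDegree 𝒟 k) := by
  have hdeg : ∀ k, famDegree (insert E (𝒟.erase D₀)) k + (if k ∈ D₀ then 1 else 0) =
      famDegree 𝒟 k + (if k ∈ E then 1 else 0) := by
    intro k
    have hE' : E ∉ 𝒟.erase D₀ := fun h => hE (mem_of_mem_erase h)
    have h1 : famDegree 𝒟 k = famDegree (𝒟.erase D₀) k + (if k ∈ D₀ then 1 else 0) := by
      conv_lhs => rw [← insert_erase hD₀]
      simp only [famDegree, card_filter]
      rw [sum_insert (notMem_erase _ _), add_comm]
    have h2 : famDegree (insert E (𝒟.erase D₀)) k =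
        famDegree (𝒟.erase D₀) k + (if k ∈ E then 1 else 0) := by
      simp only [famDegree, card_filter]
      rw [sum_insert hE', add_comm]
    omega
  have hv := hdeg v
  simp only [hvD, hvE, if_true, if_false, add_zero] at hv
  refine ⟨hv, ?_⟩
  have key : ∀ k ∈ J, halfGain (famDegree (insert E (𝒟.erase D₀)) k) ≤
      halfGain (famDegree 𝒟 k) + (if k ∈ E \ D₀ then (1 / 2 : ℝ) ^ (famDegree 𝒟 k + 1) else 0)
        - (if k = v then (1 / 2 : ℝ) ^ famDegree 𝒟 v else 0) := by
    intro k _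
    have hk := hdeg k
    by_cases hkv : k = v
    · subst hkv
      simp only [mem_sdiff, hvE, false_and, if_false, if_true, halfGain]
      rw [← hv, pow_succ]
      linarith
    · simp only [hkv, if_false, sub_zero, mem_sdiff]
      by_cases hkE : k ∈ E <;> by_cases hkD : k ∈ D₀ <;>
        simp only [hkE, hkD, if_true, if_false, add_zero, not_true, not_false_eq_true, and_true,
          and_false] at hk ⊢
      · exact halfGain_mono (by omega)
      · rw [hk, halfGain, halfGain, pow_succ]
        linarith
      · exact halfGain_mono (by omega)
      · exact halfGain_mono (by omega)
  refine (sum_le_sum key).trans ?_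
  rw [sum_sub_distrib, sum_add_distrib, sum_ite_eq' J v, if_pos hvJ, ← sum_filter,
    filter_mem_eq_inter, inter_comm]
  linarith

end Families

lemma le_choose_self {m k : ℕ} (hk : 1 ≤ k) (hkm : k + 1 ≤ m) : m ≤ m.choose k := by
  induction m generalizing k with
  | zero => omega
  | succ m ih =>
    obtain ⟨k, rfl⟩ := Nat.exists_eq_add_of_le' hk
    rw [Nat.choose_succ_succ]
    rcases Nat.eq_or_lt_of_le hkm with h | h
    · obtain rfl : m = k + 1 := by omega
      simp
    · have h1 := ih (k := k + 1) (by omega) (by omega)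
      have h2 : 0 < m.choose k := Nat.choose_pos (by omega)
      simp only [Nat.succ_eq_add_one]
      omega

lemma add_le_choose_of_degree_sum {φ q τ u X : ℕ} (hu : u = φ + q) (hτ : 1 ≤ τ) (hτu : τ + 2 ≤ u)
    (hX : X < (u - 1).choose τ) (hb : (u - 2).choose (τ - 1) + X < (u - 1).choose τ)
    (hsum : (τ + 1) * (u.choose (τ + 1) + X) ≤
      φ * u.choose τ + (q + 1) * ((u - 1).choose τ - 1)) :
    q + X ≤ (u - 1).choose τ := by
  obtain ⟨v, rfl⟩ : ∃ v, u = v + 2 := ⟨u - 2, by omega⟩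
  have h1 := Nat.add_one_mul_choose_eq (v + 1) τ
  simp only [Nat.add_sub_cancel, show v + 2 - 1 = v + 1 from rfl] at *
  set a := (v + 1).choose τ with ha
  obtain ⟨a', ha'⟩ : ∃ a', a = a' + 1 := ⟨a - 1, by omega⟩
  rcases Nat.eq_or_lt_of_le hτ with h | h
  · subst h
    simp only [Nat.choose_one_right] at *
    obtain rfl : a' = v := by omega
    simp only [ha', Nat.add_sub_cancel, show a' + 1 + 1 = a' + 2 from rfl,
      show 1 + 1 = 2 from rfl] at *
    zify at *
    have : (φ : ℤ) = a' + 2 - q := by linarith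
    rw [this] at hsum
    nlinarith
  · have h2 : v ≤ v.choose (τ - 1) := le_choose_self (by omega) (by omega)
    rcases Nat.eq_zero_or_pos φ with h0 | h0
    · by_contra hcon
      obtain rfl : q = v + 2 := by omega
      rw [h0, ha', Nat.add_sub_cancel] at hsum
      obtain rfl : a' = v + X := by omega
      rw [ha'] at h1
      nlinarith
    · omega

lemma half_pow_add_mul_half_pow_le {q X δ a : ℕ} (h1 : X ≤ δ) (h2 : δ < a) (h3 : q + X ≤ a) :
    (1 / 2 : ℝ) ^ δ + q * (1 / 2) ^ max δ (a + X - δ) ≤ (1 / 2) ^ X + q * (1 / 2) ^ a := by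
  obtain ⟨s, rfl⟩ := Nat.exists_eq_add_of_le h1
  obtain ⟨l, rfl⟩ := Nat.exists_eq_add_of_le h2.le
  have hpow : ∀ m : ℕ, 1 ≤ m → 2 * m ≤ 2 ^ m := by
    intro m hm
    induction m, hm using Nat.le_induction with
    | base => norm_num
    | succ m hm ih =>
      rw [pow_succ]
      omega
  have hq : ∀ m : ℕ, 1 ≤ m → q ≤ 2 * m → (q : ℝ) * (1 / 2) ^ m ≤ 1 := by
    intro m hm hqm
    have h : (q : ℝ) ≤ 2 ^ m := by exact_mod_cast hqm.trans (hpow m hm)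
    rw [one_div, inv_pow, ← div_eq_mul_inv, div_le_one (by positivity)]
    exact h
  have hle1 : ∀ m : ℕ, (1 / 2 : ℝ) ^ m ≤ 1 := fun m => pow_le_one₀ (by norm_num) (by norm_num)
  have hx : (0 : ℝ) < (1 / 2) ^ X := by positivity
  rcases le_total s l with hsl | hsl
  · rw [show max (X + s) (X + s + l + X - (X + s)) = X + l by omega]
    have h := hq l (by omega) (by omega)
    have hp := hle1 s
    simp only [pow_add]
    have : (1 / 2 : ℝ) ^ s + q * (1 / 2) ^ l ≤ 1 + q * (1 / 2) ^ l * (1 / 2) ^ s := by nlinarith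
    nlinarith
  · rw [show max (X + s) (X + s + l + X - (X + s)) = X + s by omega]
    have h := hq s (by omega) (by omega)
    have hp := hle1 l
    have hmono : (1 / 2 : ℝ) ^ s ≤ (1 / 2) ^ l :=
      pow_le_pow_of_le_one (by norm_num) (by norm_num) hsl
    simp only [pow_add]
    have : (1 / 2 : ℝ) ^ s + q * (1 / 2) ^ s ≤ 1 + q * (1 / 2) ^ s * (1 / 2) ^ l := by nlinarith
    nlinarith

section Core
variable {α : Type*} [DecidableEq α]

/-- The lower bound on the total gain of the vertices in `J`, for a `(τ + 1)`-uniform family on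
`S ∪ J` with `C(|S| + q, τ + 1) + X` members. -/
def GainBound (τ : ℕ) (S J : Finset α) (q X : ℕ) (𝒟 : Finset (Finset α)) : Prop :=
  (q : ℝ) * halfGain ((S.card + q - 1).choose τ) + halfGain X ≤
    ∑ k ∈ J, halfGain (famDegree 𝒟 k)

/-- `𝒟` is a `(τ + 1)`-uniform family on `S ∪ J` with `C(|S| + q, τ + 1) + X` members. -/
structure UniformFamily (τ : ℕ) (S J : Finset α) (q X : ℕ) (𝒟 : Finset (Finset α)) : Prop where
  disj : Disjoint S J
  unif : ∀ D ∈ 𝒟, D ⊆ S ∪ J ∧ D.card = τ + 1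
  card : 𝒟.card = (S.card + q).choose (τ + 1) + X

variable {τ q X : ℕ} {S J : Finset α} {𝒟 : Finset (Finset α)}

lemma UniformFamily.gainBound_zero (h : UniformFamily τ S J 0 X 𝒟) : GainBound τ S J 0 X 𝒟 := by
  have h1 := card_le_choose_add_sum_famDegree h.unif
  rw [h.card, add_zero] at h1
  have h2 := halfGain_sum_le J (famDegree 𝒟)
  have h3 := halfGain_mono (show X ≤ ∑ k ∈ J, famDegree 𝒟 k by omega)
  simp only [GainBound, Nat.cast_zero, zero_mul, zero_add]
  linarith

lemma UniformFamily.gainBound_empty (h : UniformFamily τ S ∅ (q + 1) X 𝒟) :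
    GainBound τ S ∅ (q + 1) X 𝒟 := by
  have h1 := card_le_choose_of_uniform h.unif
  rw [h.card, union_empty] at h1
  have h2 := Nat.choose_le_choose (τ + 1) (show S.card ≤ S.card + q by omega)
  have h3 := Nat.choose_succ_succ (S.card + q) τ
  rw [← add_assoc] at h1
  simp only [Nat.succ_eq_add_one] at h3
  have h4 : (S.card + q).choose τ = 0 := by omega
  have h5 : X = 0 := by omega
  simp [GainBound, ← add_assoc, h4, h5, halfGain_zero]

lemma UniformFamily.insert_erase {k : α} (h : UniformFamily τ S J (q + 1) X 𝒟) (hk : k ∈ J) :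
    UniformFamily τ (insert k S) (J.erase k) q X 𝒟 := by
  have hkS : k ∉ S := disjoint_right.1 h.disj hk
  refine ⟨?_, ?_, ?_⟩
  · rw [disjoint_insert_left]
    exact ⟨notMem_erase _ _, h.disj.mono_right (erase_subset _ _)⟩
  · rw [insert_union, ← union_insert, Finset.insert_erase hk]
    exact h.unif
  · rw [card_insert_of_notMem hkS, h.card]
    congr 2
    ring

lemma GainBound.of_insert_erase {k : α} (hkS : k ∉ S) (hk : k ∈ J)
    (hd : (S.card + q).choose τ ≤ famDegree 𝒟 k)
    (h : GainBound τ (insert k S) (J.erase k) q X 𝒟) : GainBound τ S J (q + 1) X 𝒟 := by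
  unfold GainBound at *
  rw [card_insert_of_notMem hkS] at h
  rw [← add_sum_erase J _ hk]
  have h1 := halfGain_mono hd
  rw [show S.card + 1 + q - 1 = S.card + q by omega] at h
  rw [show S.card + (q + 1) - 1 = S.card + q by omega]
  push_cast
  linarith

lemma UniformFamily.filter_notMem {v : α} (h : UniformFamily τ S J q X 𝒟) (hv : v ∈ J)
    (hd : famDegree 𝒟 v ≤ X) :
    UniformFamily τ S (J.erase v) q (X - famDegree 𝒟 v) (𝒟.filter (fun D => v ∉ D)) := by
  have hvS : v ∉ S := disjoint_right.1 h.disj hv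
  refine ⟨h.disj.mono_right (erase_subset _ _), fun D hD => ?_, ?_⟩
  · rw [mem_filter] at hD
    refine ⟨?_, (h.unif D hD.1).2⟩
    rw [← erase_eq_of_notMem hvS, ← erase_union_distrib, subset_erase]
    exact ⟨(h.unif D hD.1).1, hD.2⟩
  · have h1 := famDegree_add_card_filter_notMem 𝒟 v
    have h2 := h.card
    omega

lemma GainBound.of_filter_notMem {v : α} (hv : v ∈ J) (hd : famDegree 𝒟 v ≤ X)
    (h : GainBound τ S (J.erase v) q (X - famDegree 𝒟 v) (𝒟.filter (fun D => v ∉ D))) :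
    GainBound τ S J q X 𝒟 := by
  unfold GainBound at *
  rw [← add_sum_erase J _ hv]
  have h1 := halfGain_add_le (X - famDegree 𝒟 v) (famDegree 𝒟 v)
  rw [Nat.sub_add_cancel hd] at h1
  have h2 : ∑ k ∈ J.erase v, halfGain (famDegree (𝒟.filter (fun D => v ∉ D)) k) ≤
      ∑ k ∈ J.erase v, halfGain (famDegree 𝒟 k) :=
    sum_le_sum fun k _ => halfGain_mono (famDegree_filter_le _ _ _)
  linarith

lemma UniformFamily.card_lt (h : UniformFamily τ S J (q + 1) X 𝒟) {v : α} (hv : v ∈ J)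
    (hd : famDegree 𝒟 v < (S.card + q).choose τ) : S.card + q + 1 < S.card + J.card := by
  by_contra hcon
  have h1 := famDegree_add_card_filter_notMem 𝒟 v
  have h2 := card_filter_notMem_le h.unif (mem_union_right S hv)
  rw [card_union_of_disjoint h.disj] at h2
  have h3 := h2.trans (Nat.choose_le_choose (τ + 1)
    (show S.card + J.card - 1 ≤ S.card + q by omega))
  have h4 := Nat.choose_succ_succ (S.card + q) τ
  have h5 := h.card
  rw [← add_assoc] at h5
  simp only [Nat.succ_eq_add_one] at h4
  omega

lemma UniformFamily.gainBound_of_card_eq (h : UniformFamily τ S J (q + 1) X 𝒟) (hτ : 1 ≤ τ)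
    (hJ : J.card = q + 2) (hτu : τ + 1 ≤ S.card + q) {v : α} (hv : v ∈ J)
    (hmin : ∀ k ∈ J, famDegree 𝒟 v ≤ famDegree 𝒟 k)
    (hX : X < famDegree 𝒟 v) (hlt : ∀ k ∈ J, famDegree 𝒟 k < (S.card + q).choose τ)
    (hdual : ∀ (τ' X' : ℕ) (ℰ : Finset (Finset α)), 1 ≤ τ' → UniformFamily τ' S J q X' ℰ →
      GainBound τ' S J q X' ℰ) : GainBound τ S J (q + 1) X 𝒟 := by
  have hVcard : (S ∪ J).card = (S.card + (q + 1)) + 1 := by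
    rw [card_union_of_disjoint h.disj, hJ]; ring
  have hvlt := hlt v hv
  have hgoal : ∑ k ∈ J, (1 / 2 : ℝ) ^ famDegree 𝒟 k ≤
      (1 / 2) ^ X + ((q + 1 : ℕ) : ℝ) * (1 / 2) ^ (S.card + q).choose τ →
      GainBound τ S J (q + 1) X 𝒟 := by
    intro hs
    unfold GainBound
    rw [sum_halfGain, hJ, show S.card + (q + 1) - 1 = S.card + q by omega]
    unfold halfGain
    push_cast at *
    linarith
  have hpasc := Nat.choose_succ_succ (S.card + q - 1) (τ - 1)
  rw [Nat.succ_eq_add_one, Nat.succ_eq_add_one, Nat.sub_add_cancel hτ,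
    show S.card + q - 1 + 1 = S.card + q by omega] at hpasc
  by_cases hb : (S.card + q).choose τ ≤ (S.card + q - 1).choose (τ - 1) + X
  · obtain ⟨ℰ, hℰ, hℰc, hℰd⟩ := famDegree_dual h.unif hVcard h.card (by omega)
    have hpasc2 := Nat.choose_succ_succ (S.card + q) (τ - 1)
    rw [Nat.succ_eq_add_one, Nat.succ_eq_add_one, Nat.sub_add_cancel hτ, add_assoc] at hpasc2
    have hsymm : (S.card + q).choose (τ - 1) = (S.card + q).choose (S.card + q - τ + 1) :=
      Nat.choose_symm_of_eq_add (by omega)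
    have hsymm2 : (S.card + q - 1).choose (τ - 1) = (S.card + q - 1).choose (S.card + q - τ) :=
      Nat.choose_symm_of_eq_add (by omega)
    have hI := hdual (S.card + q - τ) ((S.card + q).choose τ - X) ℰ (by omega)
      ⟨h.disj, fun D hD => ⟨(hℰ D hD).1, by rw [(hℰ D hD).2]; omega⟩, by omega⟩
    unfold GainBound at hI
    rw [← hsymm2, sum_halfGain, hJ] at hI
    apply hgoal
    have hdeg : ∑ k ∈ J, (1 / 2 : ℝ) ^ famDegree 𝒟 k =
        (1 / 2) ^ X * ∑ k ∈ J, (1 / 2 : ℝ) ^ famDegree ℰ k := by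
      rw [mul_sum]
      refine sum_congr rfl fun k hk => ?_
      rw [← hℰd k (mem_union_right S hk), pow_add, mul_comm]
    have hpa : (1 / 2 : ℝ) ^ (S.card + q).choose τ =
        (1 / 2) ^ X * (1 / 2) ^ ((S.card + q).choose τ - X) := by
      rw [← pow_add]
      congr 1
      omega
    have hmono : (1 / 2 : ℝ) ^ (S.card + q - 1).choose (τ - 1) ≤
        (1 / 2) ^ ((S.card + q).choose τ - X) :=
      pow_le_pow_of_le_one (by norm_num) (by norm_num) (by omega)
    rw [hdeg, hpa]
    have hx : (0 : ℝ) < (1 / 2) ^ X := by positivity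
    have hq : (q : ℝ) * (1 / 2) ^ (S.card + q - 1).choose (τ - 1) ≤
        q * (1 / 2) ^ ((S.card + q).choose τ - X) :=
      mul_le_mul_of_nonneg_left hmono (Nat.cast_nonneg q)
    unfold halfGain at hI
    push_cast at *
    have : ∑ k ∈ J, (1 / 2 : ℝ) ^ famDegree ℰ k ≤
        1 + (q + 1) * (1 / 2) ^ ((S.card + q).choose τ - X) := by linarith
    nlinarith
  · have hhand : (τ + 1) * 𝒟.card ≤ S.card * (S.card + (q + 1)).choose τ +
        (q + 1 + 1) * ((S.card + q).choose τ - 1) := by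
      rw [← sum_famDegree_of_uniform h.unif, sum_union h.disj]
      refine add_le_add ?_ ?_
      · rw [← smul_eq_mul]
        refine sum_le_card_nsmul _ _ _ fun k hk => ?_
        have := famDegree_le_choose h.unif (mem_union_left J hk)
        rwa [hVcard] at this
      · rw [show q + 1 + 1 = J.card from hJ.symm, ← smul_eq_mul]
        exact sum_le_card_nsmul _ _ _ fun k hk => Nat.le_sub_one_of_lt (hlt k hk)
    rw [h.card] at hhand
    have hqX := add_le_choose_of_degree_sum (u := S.card + (q + 1)) rfl hτ (by omega)
      (X := X) (by rw [show S.card + (q + 1) - 1 = S.card + q by omega]; omega)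
      (by rw [show S.card + (q + 1) - 1 = S.card + q by omega,
            show S.card + (q + 1) - 2 = S.card + q - 1 by omega]; omega)
      (by rw [show S.card + (q + 1) - 1 = S.card + q by omega]; exact hhand)
    rw [show S.card + (q + 1) - 1 = S.card + q by omega] at hqX
    apply hgoal
    refine le_trans ?_ (half_pow_add_mul_half_pow_le hX.le hvlt hqX)
    rw [← add_sum_erase J _ hv]
    refine add_le_add le_rfl ?_
    have hcard : (J.erase v).card = q + 1 := by rw [card_erase_of_mem hv, hJ]; rfl
    rw [← hcard, ← nsmul_eq_mul]
    refine sum_le_card_nsmul _ _ _ fun k hk => ?_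
    refine pow_le_pow_of_le_one (by norm_num) (by norm_num) ?_
    have hkJ := mem_of_mem_erase hk
    have := add_choose_le_famDegree_add_famDegree h.unif (by omega) hVcard h.card
      (mem_union_right S hv) (mem_union_right S hkJ) (ne_of_mem_erase hk).symm
    rw [show S.card + (q + 1) - 1 = S.card + q by omega] at this
    have := hmin k hkJ
    omega

lemma UniformFamily.gainBound_of_le_two_pow (hJ : q + 3 ≤ J.card) {v : α}
    (hmin : ∀ k ∈ J, famDegree 𝒟 v ≤ famDegree 𝒟 k) (hX : X < famDegree 𝒟 v)
    (hq : q + 1 ≤ 2 ^ famDegree 𝒟 v) : GainBound τ S J (q + 1) X 𝒟 := by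
  unfold GainBound
  rw [sum_halfGain]
  obtain ⟨N, hN⟩ := Nat.exists_eq_add_of_le hJ
  have h1 : ∑ k ∈ J, (1 / 2 : ℝ) ^ famDegree 𝒟 k ≤ J.card * (1 / 2) ^ famDegree 𝒟 v := by
    rw [← nsmul_eq_mul]
    exact sum_le_card_nsmul _ _ _ fun k hk =>
      pow_le_pow_of_le_one (by norm_num) (by norm_num) (hmin k hk)
  have h2 : ((q + 1 : ℕ) : ℝ) * (1 / 2) ^ famDegree 𝒟 v ≤ 1 := by
    have h : ((q + 1 : ℕ) : ℝ) ≤ 2 ^ famDegree 𝒟 v := by exact_mod_cast hq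
    rw [one_div, inv_pow, ← div_eq_mul_inv, div_le_one (by positivity)]
    exact h
  have h3 : 2 * (1 / 2 : ℝ) ^ famDegree 𝒟 v ≤ (1 / 2) ^ X := by
    have : (1 / 2 : ℝ) ^ famDegree 𝒟 v ≤ (1 / 2) ^ (X + 1) :=
      pow_le_pow_of_le_one (by norm_num) (by norm_num) hX
    rw [pow_succ] at this
    linarith
  have h4 : (N : ℝ) * (1 / 2) ^ famDegree 𝒟 v ≤ N :=
    mul_le_of_le_one_right (Nat.cast_nonneg N) (pow_le_one₀ (by norm_num) (by norm_num))
  have h5 : 0 ≤ (((q + 1 : ℕ)) : ℝ) * (1 / 2) ^ (S.card + (q + 1) - 1).choose τ := by positivity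
  unfold halfGain
  rw [hN] at *
  push_cast at *
  nlinarith

lemma UniformFamily.exists_notMem (h : UniformFamily τ S J (q + 1) X 𝒟) (hJ : q + 3 ≤ J.card)
    {v : α} (hv : v ∈ J) (hX : X < famDegree 𝒟 v)
    (hlt : famDegree 𝒟 v < (S.card + q).choose τ) :
    ∃ E ⊆ S ∪ J, E.card = τ + 1 ∧ v ∉ E ∧ E ∉ 𝒟 := by
  by_contra! hcon
  have hsub : ((S ∪ J).erase v).powersetCard (τ + 1) ⊆ 𝒟.filter (fun D => v ∉ D) := by
    intro E hE
    rw [mem_powersetCard, subset_erase] at hE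
    exact mem_filter.2 ⟨hcon E hE.1.1 hE.2 hE.1.2, hE.1.2⟩
  have h1 := card_le_card hsub
  rw [card_powersetCard, card_erase_of_mem (mem_union_right S hv),
    card_union_of_disjoint h.disj] at h1
  have h2 := famDegree_add_card_filter_notMem 𝒟 v
  have h3 := Nat.choose_le_choose (τ + 1)
    (show S.card + q + 1 + 1 ≤ S.card + J.card - 1 by omega)
  have h4 := Nat.choose_succ_succ (S.card + q + 1) τ
  have h5 := Nat.choose_le_choose τ (show S.card + q ≤ S.card + q + 1 by omega)
  have h6 := h.card
  rw [← add_assoc] at h6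
  simp only [Nat.succ_eq_add_one] at h4
  omega

lemma mul_self_le_two_pow (m : ℕ) : m * m ≤ 2 ^ (m + 1) := by
  induction m with
  | zero => norm_num
  | succ m ih =>
    have := m.lt_two_pow_self
    rw [pow_succ] at *
    rw [pow_succ]
    nlinarith

lemma UniformFamily.exists_swap (h : UniformFamily τ S J (q + 1) X 𝒟) (hτ : 1 ≤ τ)
    (hJ : q + 3 ≤ J.card) (hτu : τ + 1 ≤ S.card + q) {v : α} (hv : v ∈ J)
    (hmin : ∀ k ∈ J, famDegree 𝒟 v ≤ famDegree 𝒟 k) (hX : X < famDegree 𝒟 v)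
    (hlt : famDegree 𝒟 v < (S.card + q).choose τ) (hq : 2 ^ famDegree 𝒟 v ≤ q) :
    ∃ 𝒟' : Finset (Finset α), UniformFamily τ S J (q + 1) X 𝒟' ∧
      famDegree 𝒟' v + 1 = famDegree 𝒟 v ∧
      ∑ k ∈ J, halfGain (famDegree 𝒟' k) ≤ ∑ k ∈ J, halfGain (famDegree 𝒟 k) := by
  obtain ⟨D₀, hD₀⟩ := card_pos.1 (show 0 < famDegree 𝒟 v by omega)
  rw [mem_filter] at hD₀
  obtain ⟨hD₀, hvD⟩ := hD₀
  suffices hE : ∃ E ⊆ S ∪ J, E.card = τ + 1 ∧ v ∉ E ∧ E ∉ 𝒟 ∧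
      ∑ w ∈ (E \ D₀) ∩ J, (1 / 2 : ℝ) ^ (famDegree 𝒟 w + 1) ≤ (1 / 2) ^ famDegree 𝒟 v by
    obtain ⟨E, hEV, hEc, hvE, hE, hsum⟩ := hE
    refine ⟨insert E (𝒟.erase D₀), ⟨h.disj, ?_, ?_⟩,
      sum_halfGain_swap_le hD₀ hE hvD hvE hv hsum⟩
    · intro D hD
      rcases mem_insert.1 hD with rfl | hD
      · exact ⟨hEV, hEc⟩
      · exact h.unif D (mem_of_mem_erase hD)
    · rw [card_insert_of_notMem fun hh => hE (mem_of_mem_erase hh),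
        card_erase_add_one hD₀, h.card]
  by_cases hc : ∃ E ⊆ S ∪ J, E.card = τ + 1 ∧ v ∉ E ∧ (E \ D₀).card ≤ 2 ∧ E ∉ 𝒟
  · obtain ⟨E, hEV, hEc, hvE, hE2, hE⟩ := hc
    refine ⟨E, hEV, hEc, hvE, hE, ?_⟩
    have h1 : ∑ w ∈ (E \ D₀) ∩ J, (1 / 2 : ℝ) ^ (famDegree 𝒟 w + 1) ≤
        (((E \ D₀) ∩ J).card : ℝ) * (1 / 2) ^ (famDegree 𝒟 v + 1) := by
      rw [← nsmul_eq_mul]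
      exact sum_le_card_nsmul _ _ _ fun k hk => pow_le_pow_of_le_one (by norm_num) (by norm_num)
        (Nat.succ_le_succ (hmin k (mem_inter.1 hk).2))
    have h2 : (((E \ D₀) ∩ J).card : ℝ) ≤ 2 := by
      exact_mod_cast (card_le_card inter_subset_left).trans hE2
    have h3 : (0 : ℝ) < (1 / 2) ^ famDegree 𝒟 v := by positivity
    rw [pow_succ] at h1
    nlinarith
  · obtain ⟨E, hEV, hEc, hvE, hE⟩ := h.exists_notMem hJ hv hX hlt
    refine ⟨E, hEV, hEc, hvE, hE, ?_⟩
    have hall : ∀ E ⊆ S ∪ J, E.card = τ + 1 → v ∉ E → (E \ D₀).card ≤ 2 → E ∈ 𝒟 := by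
      by_contra! hcon
      exact hc hcon
    have hdeg : ∀ w ∈ (E \ D₀) ∩ J, S.card + q + 1 ≤ famDegree 𝒟 w + 1 := by
      intro w hw
      rw [mem_inter, mem_sdiff] at hw
      have h1 := mul_le_famDegree (h.unif D₀ hD₀).1 (h.unif D₀ hD₀).2 hvD (hEV hw.1.1) hw.1.2 hall
      rw [card_union_of_disjoint h.disj] at h1
      obtain ⟨b, hb⟩ := Nat.exists_eq_add_of_le hτu
      have h2 : b + 2 ≤ S.card + J.card - (τ + 2) := by omega
      nlinarith [Nat.mul_le_mul_left τ h2]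
    have h1 : ∑ w ∈ (E \ D₀) ∩ J, (1 / 2 : ℝ) ^ (famDegree 𝒟 w + 1) ≤
        (((E \ D₀) ∩ J).card : ℝ) * (1 / 2) ^ (S.card + q + 1) := by
      rw [← nsmul_eq_mul]
      exact sum_le_card_nsmul _ _ _ fun k hk => pow_le_pow_of_le_one (by norm_num) (by norm_num)
        (hdeg k hk)
    have h2 : (((E \ D₀) ∩ J).card : ℝ) ≤ ((S.card + q : ℕ) : ℝ) := by
      exact_mod_cast (card_le_card (inter_subset_left.trans sdiff_subset)).trans (hEc ▸ hτu)
    have h3 : (S.card + q) * 2 ^ famDegree 𝒟 v ≤ 2 ^ (S.card + q + 1) :=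
      (Nat.mul_le_mul_left _ (by omega)).trans (mul_self_le_two_pow (S.card + q))
    have h4 : ((S.card + q : ℕ) : ℝ) * 2 ^ famDegree 𝒟 v ≤ 2 ^ (S.card + q + 1) := by
      exact_mod_cast h3
    refine (h1.trans (mul_le_mul_of_nonneg_right h2 (by positivity))).trans ?_
    rw [one_div, inv_pow, inv_pow, ← div_eq_mul_inv, div_le_iff₀ (by positivity),
      inv_mul_eq_div, le_div_iff₀ (by positivity)]
    exact h4

/-- The total gain is smallest when `q` vertices of `J` complete a clique on `S` and one more
vertex carries the remaining `X` sets. -/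
theorem UniformFamily.gainBound (hτ : 1 ≤ τ) (h : UniformFamily τ S J q X 𝒟) :
    GainBound τ S J q X 𝒟 := by
  obtain ⟨M, hM⟩ : ∃ M, J.card + q < M := ⟨_, Nat.lt_succ_self _⟩
  induction M generalizing τ S J q X 𝒟 with
  | zero => omega
  | succ M ih =>
  cases q with
  | zero => exact h.gainBound_zero
  | succ q =>
  rcases J.eq_empty_or_nonempty with rfl | hne
  · exact h.gainBound_empty
  obtain ⟨c, hc⟩ : ∃ c, ∃ v ∈ J, famDegree 𝒟 v ≤ c := by
    obtain ⟨v, hv⟩ := hne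
    exact ⟨_, v, hv, le_rfl⟩
  induction c generalizing 𝒟 with
  | zero =>
    obtain ⟨v, hv, hd⟩ := hc
    have hd' : famDegree 𝒟 v ≤ X := by omega
    refine .of_filter_notMem hv hd' (ih hτ (h.filter_notMem hv hd') ?_)
    have := card_erase_lt_of_mem hv
    omega
  | succ c ihc =>
  by_cases hbig : ∃ k ∈ J, (S.card + q).choose τ ≤ famDegree 𝒟 k
  · obtain ⟨k, hk, hd⟩ := hbig
    refine .of_insert_erase (disjoint_right.1 h.disj hk) hk hd (ih hτ (h.insert_erase hk) ?_)
    have := card_erase_lt_of_mem hk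
    omega
  push Not at hbig
  obtain ⟨v, hv, hmin⟩ := exists_min_image J (famDegree 𝒟) hne
  by_cases hX : famDegree 𝒟 v ≤ X
  · refine .of_filter_notMem hv hX (ih hτ (h.filter_notMem hv hX) ?_)
    have := card_erase_lt_of_mem hv
    omega
  push Not at hX
  have hlt := hbig v hv
  have hτu : τ + 1 ≤ S.card + q := by
    by_contra hcon
    have h1 := Nat.choose_le_choose τ (show S.card + q ≤ τ by omega)
    rw [Nat.choose_self] at h1
    omega
  have hJ := h.card_lt hv hlt
  rcases Nat.eq_or_lt_of_le (show q + 2 ≤ J.card by omega) with hJ' | hJ'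
  · exact h.gainBound_of_card_eq hτ hJ'.symm hτu hv hmin hX hbig
      fun τ' X' ℰ hτ' hℰ => ih hτ' hℰ (by omega)
  rcases le_or_gt (q + 1) (2 ^ famDegree 𝒟 v) with h2 | h2
  · exact gainBound_of_le_two_pow hJ' hmin hX h2
  obtain ⟨𝒟', h', hd', hsum⟩ := h.exists_swap hτ hJ' hτu hv hmin hX hlt (by omega)
  obtain ⟨k, hk, hkc⟩ := hc
  exact (ihc h' ⟨v, hv, by have := hmin k hk; omega⟩).trans hsum

end Core

/-- The number `2ˣ - 1` of nonempty subsets of a set of `x` messages, as a real number. -/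
noncomputable def macCount (x : ℕ) : ℝ := 2 ^ x - 1

lemma macCount_zero : macCount 0 = 0 := by simp [macCount]

lemma macCount_mono {x y : ℕ} (h : x ≤ y) : macCount x ≤ macCount y := by
  have : (2 : ℝ) ^ x ≤ 2 ^ y := pow_le_pow_right₀ (by norm_num) h
  unfold macCount
  linarith

lemma macCount_nonneg (x : ℕ) : 0 ≤ macCount x := by
  simpa [macCount_zero] using macCount_mono (Nat.zero_le x)

lemma macCount_add (x y : ℕ) : macCount (x + y) = macCount x + 2 ^ x * macCount y := by
  unfold macCount
  rw [pow_add]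
  ring

lemma two_pow_mul_halfGain {W d : ℕ} (h : d ≤ W) :
    2 ^ W * halfGain d = macCount W - macCount (W - d) := by
  obtain ⟨e, rfl⟩ := Nat.exists_eq_add_of_le h
  rw [Nat.add_sub_cancel_left]
  unfold halfGain macCount
  rw [pow_add, one_div, inv_pow]
  field_simp
  ring

lemma mul_macCount_le {x y : ℕ} (h : x ≤ y) : (y : ℝ) * macCount x ≤ x * macCount y := by
  induction y, h using Nat.le_induction with
  | base => exact le_rfl
  | succ y h ih =>
    have h1 := macCount_mono h
    have h2 := macCount_add y 1
    have h3 : macCount 1 = 1 := by norm_num [macCount]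
    have h4 : (2 : ℝ) ^ y = macCount y + 1 := by simp [macCount]
    have h5 : macCount x ≤ x * 2 ^ y := by
      rcases Nat.eq_zero_or_pos x with rfl | hx
      · simp [macCount_zero]
      · have : (1 : ℝ) ≤ x := by exact_mod_cast hx
        have := macCount_nonneg y
        nlinarith
    rw [h2, h3, mul_one, mul_add]
    push_cast
    linarith

lemma macCount_le_sub_mul {w m B C : ℕ} (hw : w + m ≤ C) (hB : B ≤ C) :
    macCount w ≤ macCount C - macCount B / B * m := by
  obtain ⟨e, rfl⟩ := Nat.exists_eq_add_of_le hw
  suffices macCount B / B * m ≤ 2 ^ (w + e) * macCount m by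
    have h1 := macCount_mono (Nat.le_add_right w e)
    rw [show w + m + e = w + e + m by ring, macCount_add]
    linarith
  rcases Nat.eq_zero_or_pos B with rfl | hB0
  · rw [macCount_zero, zero_div, zero_mul]
    have := macCount_nonneg m
    positivity
  have hB0' : (0 : ℝ) < B := by exact_mod_cast hB0
  rw [div_mul_eq_mul_div, div_le_iff₀ hB0']
  have hm := macCount_nonneg m
  rcases le_total B m with h | h
  · have h1 := mul_macCount_le h
    have h2 : (1 : ℝ) ≤ 2 ^ (w + e) := one_le_pow₀ (by norm_num)
    have h3 := mul_le_mul_of_nonneg_right h2 (mul_nonneg hm hB0'.le)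
    linarith
  · obtain ⟨b, rfl⟩ := Nat.exists_eq_add_of_le' h
    have h1 := mul_macCount_le h
    have h2 := mul_macCount_le (Nat.le_add_right b m)
    have h3 : (2 : ℝ) ^ b ≤ 2 ^ (w + e) := pow_le_pow_right₀ (by norm_num) (by omega)
    have h4 := mul_le_mul_of_nonneg_right h3 (mul_nonneg hm hB0'.le)
    rw [macCount_add] at *
    push_cast at *
    linarith

lemma mul_macCount_le_of_mul_le {φ B m : ℕ} (h : φ * B ≤ m) :
    (φ : ℝ) * macCount B ≤ macCount B / B * m := by
  rcases Nat.eq_zero_or_pos B with rfl | hB0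
  · simp [macCount_zero]
  have hB0' : (0 : ℝ) < B := by exact_mod_cast hB0
  have h' : (φ : ℝ) * B ≤ m := by exact_mod_cast h
  rw [div_mul_eq_mul_div, le_div_iff₀ hB0']
  nlinarith [macCount_nonneg B]

lemma sum_macCount_le {α : Type*} (T : Finset α) {w m c : α → ℕ} {B : ℕ}
    (hw : ∀ k ∈ T, w k + m k ≤ c k) (hB : ∀ k ∈ T, B ≤ c k) :
    ∑ k ∈ T, macCount (w k) ≤
      ∑ k ∈ T, macCount (c k) - macCount B / B * ((∑ k ∈ T, m k : ℕ) : ℝ) := by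
  push_cast
  rw [mul_sum, ← sum_sub_distrib]
  exact sum_le_sum fun k hk => macCount_le_sub_mul (hw k hk) (hB k hk)

lemma sum_macCount_le_of_const {α : Type*} (T : Finset α) {w m : α → ℕ} {B C : ℕ}
    (hw : ∀ k ∈ T, w k + m k ≤ C) (hB : B ≤ C) :
    ∑ k ∈ T, macCount (w k) ≤
      T.card * macCount C - macCount B / B * ((∑ k ∈ T, m k : ℕ) : ℝ) := by
  have := sum_macCount_le T (c := fun _ => C) hw fun _ _ => hB
  simpa using this

section Mac
variable {α : Type*} [DecidableEq α] [Fintype α] {𝒟 : Finset (Finset α)} {τ u W X φ : ℕ}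
  {w m : α → ℕ}

lemma sum_macCount_le_of_subset (S : Finset α) {B : ℕ} (hB : B ≤ W)
    (hw : ∀ k, w k + m k ≤ W) (hS : ∀ k ∈ S, w k + m k ≤ B) :
    ∑ k, macCount (w k) ≤ (Fintype.card α - S.card) * macCount W + S.card * macCount B -
      macCount B / B * ((∑ k, m k : ℕ) : ℝ) := by
  have h1 := sum_macCount_le_of_const S hS le_rfl
  have h2 := sum_macCount_le_of_const Sᶜ (fun k _ => hw k) hB
  rw [← sum_add_sum_compl S (fun k => macCount (w k)), ← sum_add_sum_compl S m]
  rw [card_compl, Nat.cast_sub (card_le_univ S)] at h2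
  push_cast at *
  linarith

/-- The case in which all members of the family lie in a set of `u + 1` users. -/
lemma sum_macCount_le_of_forall_subset (hcard : 𝒟.card = u.choose (τ + 1) + X)
    (hw : ∀ k, w k + m k + famDegree 𝒟 k = W) {S : Finset α} (hS : S.card = u + 1)
    (hD : ∀ D ∈ 𝒟, D ⊆ S ∧ D.card = τ + 1) (hAX : (u - 1).choose τ ≤ X) (hφu : φ ≤ u)
    (hφ : φ * (W - (u - 1).choose τ) ≤ ∑ k, m k) :
    ∑ k, macCount (w k) ≤ (Fintype.card α - (u + 1)) * macCount W +
      (u - φ) * macCount (W - (u - 1).choose τ) + macCount (W - X) := by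
  have hdeg : ∀ k ∈ S, X ≤ famDegree 𝒟 k := by
    intro k hk
    have h1 := famDegree_add_card_filter_notMem 𝒟 k
    have h2 := card_filter_notMem_le hD hk
    rw [hS, Nat.add_sub_cancel] at h2
    omega
  have h1 := sum_macCount_le_of_subset S (Nat.sub_le W X)
    (fun k => by have := hw k; omega : ∀ k, w k + m k ≤ W)
    (fun k hk => by have := hw k; have := hdeg k hk; omega)
  have h2 := mul_macCount_le_of_mul_le (B := W - X)
    ((Nat.mul_le_mul_left φ (Nat.sub_le_sub_left hAX W)).trans hφ)
  have h3 := macCount_mono (Nat.sub_le_sub_left hAX W)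
  have h4 : (φ : ℝ) ≤ u := by exact_mod_cast hφu
  rw [hS] at h1
  push_cast at *
  nlinarith

/-- The case in which at most `u` users have degree at least `C(u - 1, τ)`. -/
lemma sum_macCount_le_of_card_le (hτ : 1 ≤ τ) (hD : ∀ D ∈ 𝒟, D.card = τ + 1)
    (hcard : 𝒟.card = u.choose (τ + 1) + X)
    (hw : ∀ k, w k + m k + famDegree 𝒟 k = W) (hXW : X ≤ W) (hAW : (u - 1).choose τ ≤ W)
    (hS : (univ.filter (fun k => (u - 1).choose τ ≤ famDegree 𝒟 k)).card ≤ u)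
    (hφ : φ * (W - (u - 1).choose τ) ≤ ∑ k, m k) :
    ∑ k, macCount (w k) ≤ (Fintype.card α - (u + 1)) * macCount W +
      (u - φ) * macCount (W - (u - 1).choose τ) + macCount (W - X) := by
  set S := univ.filter (fun k => (u - 1).choose τ ≤ famDegree 𝒟 k) with hSdef
  have hfam : UniformFamily τ S Sᶜ (u - S.card) X 𝒟 := by
    refine ⟨disjoint_compl_right, fun D h => ⟨?_, hD D h⟩, ?_⟩
    · rw [union_compl]
      exact subset_univ D
    · rw [Nat.add_sub_cancel' hS, hcard]
  have hgain := hfam.gainBound hτ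
  rw [GainBound, Nat.add_sub_cancel' hS, Nat.cast_sub hS] at hgain
  have h1 := mul_le_mul_of_nonneg_left hgain (show (0 : ℝ) ≤ 2 ^ W by positivity)
  have h2 : 2 ^ W * ∑ k ∈ Sᶜ, halfGain (famDegree 𝒟 k) =
      (Fintype.card α - S.card) * macCount W - ∑ k ∈ Sᶜ, macCount (W - famDegree 𝒟 k) := by
    rw [mul_sum, sum_congr rfl fun k _ => two_pow_mul_halfGain
      (show famDegree 𝒟 k ≤ W by have := hw k; omega), sum_sub_distrib, sum_const, card_compl,
      nsmul_eq_mul, Nat.cast_sub (card_le_univ S)]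
  rw [h2, mul_add, two_pow_mul_halfGain hXW, mul_left_comm, two_pow_mul_halfGain hAW] at h1
  have h3 := sum_macCount_le Sᶜ (w := w) (m := m) (B := W - (u - 1).choose τ)
    (c := fun k => W - famDegree 𝒟 k) (fun k _ => by have := hw k; omega) (fun k hk => by
      have hk' : ¬(u - 1).choose τ ≤ famDegree 𝒟 k := by simpa [hSdef] using hk
      omega)
  have h4 := sum_macCount_le_of_const S (w := w) (m := m) (C := W - (u - 1).choose τ)
    (fun k hk => by
      have hk' : (u - 1).choose τ ≤ famDegree 𝒟 k := by simpa [hSdef] using hk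
      have := hw k
      omega) le_rfl
  have h5 := mul_macCount_le_of_mul_le hφ
  rw [← sum_add_sum_compl S (fun k => macCount (w k))]
  rw [← sum_add_sum_compl S m] at h5
  push_cast at *
  linarith

/-- The case in which `u + 1` users have degree at least `C(u - 1, τ)`. -/
lemma sum_macCount_le_of_lt_card (hD : ∀ D ∈ 𝒟, D.card = τ + 1)
    (hcard : 𝒟.card = u.choose (τ + 1) + X) (hX : X ≤ u.choose τ) (hτu : τ ≤ u)
    (hw : ∀ k, w k + m k + famDegree 𝒟 k = W)
    (hS : u < (univ.filter (fun k => (u - 1).choose τ ≤ famDegree 𝒟 k)).card) (hφu : φ ≤ u)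
    (hφ : φ * (W - (u - 1).choose τ) ≤ ∑ k, m k) :
    ∑ k, macCount (w k) ≤ (Fintype.card α - (u + 1)) * macCount W +
      (u - φ) * macCount (W - (u - 1).choose τ) + macCount (W - X) := by
  obtain ⟨S, hSsub, hSc⟩ := exists_subset_card_eq (Nat.succ_le_of_lt hS)
  have hwW : ∀ k, w k + m k ≤ W := fun k => by have := hw k; omega
  have hwS : ∀ k ∈ S, w k + m k ≤ W - (u - 1).choose τ := fun k hk => by
    have := hw k
    have := (mem_filter.1 (hSsub hk)).2
    omega
  have hφ' := mul_macCount_le_of_mul_le hφ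
  have hn := macCount_nonneg (W - X)
  rcases le_or_gt X ((u - 1).choose τ) with hXA | hXA
  · have h1 := sum_macCount_le_of_subset S (Nat.sub_le W ((u - 1).choose τ)) hwW hwS
    have h2 := macCount_mono (Nat.sub_le_sub_left hXA W)
    rw [hSc] at h1
    push_cast at *
    linarith
  by_cases hsub : ∀ D ∈ 𝒟, D ⊆ S
  · exact sum_macCount_le_of_forall_subset hcard hw hSc (fun D h => ⟨hsub D h, hD D h⟩)
      hXA.le hφu hφ
  rcases Nat.eq_zero_or_pos ((u - 1).choose τ) with hA | hA
  · have hu : u = τ := by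
      rw [Nat.choose_eq_zero_iff] at hA
      omega
    subst hu
    rw [Nat.choose_self] at hX
    rw [Nat.choose_succ_self, zero_add] at hcard
    obtain ⟨D, rfl⟩ := card_eq_one.1 (show 𝒟.card = 1 by omega)
    refine sum_macCount_le_of_forall_subset (S := D) ?_ hw (hD D (mem_singleton_self D)) ?_
      hXA.le hφu hφ
    · rw [Nat.choose_succ_self, zero_add, hcard]
    · intro E hE
      exact ⟨(mem_singleton.1 hE).subset, hD E hE⟩
  · push Not at hsub
    obtain ⟨D, hDm, hDS⟩ := hsub
    obtain ⟨j, hjD, hjS⟩ := not_subset.1 hDS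
    have hj : 0 < famDegree 𝒟 j := card_pos.2 ⟨D, mem_filter.2 ⟨hDm, hjD⟩⟩
    have hwj := hw j
    have h1 := macCount_le_sub_mul (show w j + m j ≤ W - 1 by omega)
      (show W - (u - 1).choose τ ≤ W - 1 by omega)
    have h2 := sum_macCount_le_of_const S hwS le_rfl
    have hjS' : j ∈ Sᶜ := mem_compl.2 hjS
    have h3 := sum_macCount_le_of_const (Sᶜ.erase j) (fun k _ => hwW k)
      (Nat.sub_le W ((u - 1).choose τ))
    have hce := card_erase_add_one hjS'
    rw [card_compl] at hce
    have hce' : ((Sᶜ.erase j).card : ℝ) = Fintype.card α - (u + 1) - 1 := by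
      have := card_le_univ S
      have h4 : (Sᶜ.erase j).card + 1 + (u + 1) = Fintype.card α := by omega
      rw [← h4]
      push_cast
      ring
    have h5 := macCount_mono (show W - (u - 1).choose τ ≤ W - 1 by omega)
    have h6 := macCount_add (W - 1) 1
    rw [Nat.sub_add_cancel (by omega : 1 ≤ W)] at h6
    have h7 : (2 : ℝ) ^ (W - 1) = macCount (W - 1) + 1 := by simp [macCount]
    have h8 : macCount 1 = 1 := by norm_num [macCount]
    rw [← sum_add_sum_compl S m, ← add_sum_erase Sᶜ m hjS'] at hφ'
    rw [← sum_add_sum_compl S (fun k => macCount (w k)), ← add_sum_erase Sᶜ _ hjS']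
    rw [hce'] at h3
    rw [hSc] at h2
    rw [h8, mul_one, h7] at h6
    push_cast at *
    linarith

end Mac

/-- Theorem 1 (maximum number of MAC conditions). -/
theorem max_num_mac_conditions (τ L : ℕ) (hτ : 1 ≤ τ) (hL : 1 ≤ L) (n W MT : ℕ)
    (hn : n = τ + L) (hW : W = Nat.choose (n - 1) τ) (hMT : MT = Nat.choose n (τ + 1))
    (𝒟 : Finset (Finset (Fin n))) (i : ℕ) (hi : i = 𝒟.card)
    (h1i : 1 ≤ i) (hiMT : i ≤ MT)
    (hDcard : ∀ D ∈ 𝒟, D.card = τ + 1)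
    (mk : Fin n → ℕ) (m : ℕ) (hm : ∑ k, mk k = m)
    (hle : ∀ k : Fin n, (𝒟.filter (fun D => k ∈ D)).card + mk k ≤ W)
    (w : Fin n → ℕ) (hw : ∀ k, w k = W - (𝒟.filter (fun D => k ∈ D)).card - mk k)
    (U : ℕ) (hU : IsLeast {u : ℕ | i ≤ Nat.choose u (τ + 1)} U)
    (X : ℕ) (hX : X = i - Nat.choose (U - 1) (τ + 1))
    (φ : ℕ) (hφ : φ = m / (W - Nat.choose (U - 2) τ))
    (hφU : φ + 1 ≤ U) :
    ∑ k, (2 ^ w k - 1) ≤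
      (n - U) * (2 ^ W - 1) +
        (U - (φ + 1)) * (2 ^ (W - Nat.choose (U - 2) τ) - 1) +
        (2 ^ (W - X) - 1) := by
  subst hn hMT hi hm
  have hτU : τ + 1 ≤ U := by
    by_contra hcon
    have h1 : 𝒟.card ≤ U.choose (τ + 1) := hU.1
    rw [Nat.choose_eq_zero_of_lt (by omega)] at h1
    omega
  have hUn : U ≤ τ + L := hU.2 hiMT
  obtain ⟨u, rfl⟩ := Nat.exists_eq_add_of_le' (show 1 ≤ U by omega)
  have hUi : 𝒟.card ≤ (u + 1).choose (τ + 1) := hU.1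
  have hui : u.choose (τ + 1) < 𝒟.card := by
    by_contra! hcon
    have : u + 1 ≤ u := hU.2 hcon
    omega
  rw [Nat.add_sub_cancel] at hX
  rw [show u + 1 - 2 = u - 1 by omega] at *
  have hpasc := Nat.choose_succ_succ u τ
  simp only [Nat.succ_eq_add_one] at hpasc
  have hXu : X ≤ u.choose τ := by omega
  have huW : u.choose τ ≤ W := hW ▸ Nat.choose_le_choose τ (by omega)
  have hAW : (u - 1).choose τ ≤ W :=
    (Nat.choose_le_choose τ (Nat.sub_le u 1)).trans huW
  have hcard : 𝒟.card = u.choose (τ + 1) + X := by omega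
  have hφu : φ ≤ u := by omega
  have hφm : φ * (W - (u - 1).choose τ) ≤ ∑ k, mk k := hφ ▸ Nat.div_mul_le_self _ _
  have hw' : ∀ k, w k + mk k + famDegree 𝒟 k = W := fun k => by
    have h1 := hle k
    have h2 := hw k
    change famDegree 𝒟 k + mk k ≤ W at h1
    change w k = W - famDegree 𝒟 k - mk k at h2
    omega
  have key : ∑ k, macCount (w k) ≤ (Fintype.card (Fin (τ + L)) - (u + 1)) * macCount W +
      (u - φ) * macCount (W - (u - 1).choose τ) + macCount (W - X) := by
    rcases le_or_gt (univ.filter (fun k => (u - 1).choose τ ≤ famDegree 𝒟 k)).card u with h | h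
    · exact sum_macCount_le_of_card_le hτ hDcard hcard hw' (hXu.trans huW) hAW h hφm
    · exact sum_macCount_le_of_lt_card hDcard hcard hXu (by omega) hw' h hφu hφm
  have hcast : ∀ x : ℕ, ((2 ^ x - 1 : ℕ) : ℝ) = macCount x := fun x => by
    rw [Nat.cast_sub Nat.one_le_two_pow, macCount]
    push_cast
    rfl
  rw [← Nat.cast_le (α := ℝ), Nat.cast_sum, Nat.cast_add, Nat.cast_add, Nat.cast_mul,
    Nat.cast_mul, Nat.cast_sub hUn, Nat.cast_sub hφU, hcast, hcast, hcast,
    sum_congr rfl fun k _ => hcast (w k)]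
  rw [Fintype.card_fin] at key
  push_cast at *
  linarith
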